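/- For all μ > 0, λ > 0 and x > 0, ∫₀ˣ (λ^{5/2}μ²/(√(2π)(λ²+3λμ+3μ²))) z^{−7/2} E(z;μ,λ) dz = Φ(√(λ/x)·(x/μ − 1)) + ((λ²−3λμ+3μ²)/(λ²+3λμ+3μ²))·exp(2λ/μ)·Φ(−√(λ/x)·(x/μ + 1)) + (√(2λ)·μ²·(λ+3x)/(√π·(λ²+3λμ+3μ²)·x^{3/2}))·exp(λ/μ)·exp(−(λ/(2x))·(x²/μ² + 1)). (This is the cumulative distribution function of the generalized inverse Gaussian distribution with p = −5/2.) -/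

import Mathlib

open MeasureTheory Real

/-- Standard normal cumulative distribution function. -/
noncomputable def stdNormalCDF (x : ℝ) : ℝ :=
  ∫ t in Set.Iic x, (Real.sqrt (2 * Real.pi))⁻¹ * Real.exp (-t ^ 2 / 2)

/-- The exponential factor `E(z; μ, λ) = exp(−λ(z−μ)²/(2μ²z))`. -/
noncomputable def gigE (z μ lam : ℝ) : ℝ :=
  Real.exp (-(lam * (z - μ) ^ 2) / (2 * μ ^ 2 * z))

lemma gig_aux_integrable :
    Integrable (fun t : ℝ => (Real.sqrt (2 * Real.pi))⁻¹ * Real.exp (-t ^ 2 / 2)) := by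
  have h := (integrable_exp_neg_mul_sq (b := 1/2) (by norm_num)).const_mul
    ((Real.sqrt (2 * Real.pi))⁻¹)
  refine h.congr (Filter.Eventually.of_forall fun t => ?_)
  simp only
  congr 2
  ring

lemma gig_aux_Phi_eq (x : ℝ) : stdNormalCDF x = stdNormalCDF 0 +
    ∫ t in (0:ℝ)..x, (Real.sqrt (2 * Real.pi))⁻¹ * Real.exp (-t ^ 2 / 2) := by
  have := intervalIntegral.integral_Iic_sub_Iic (a := 0) (b := x)
    (gig_aux_integrable.integrableOn) (gig_aux_integrable.integrableOn)
  unfold stdNormalCDF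
  linarith

lemma gig_aux_Phi_deriv (x : ℝ) : HasDerivAt stdNormalCDF
    ((Real.sqrt (2 * Real.pi))⁻¹ * Real.exp (-x ^ 2 / 2)) x := by
  have hc : Continuous
      (fun t : ℝ => (Real.sqrt (2 * Real.pi))⁻¹ * Real.exp (-t ^ 2 / 2)) := by fun_prop
  have h := (hc.integral_hasStrictDerivAt 0 x).hasDerivAt.const_add (stdNormalCDF 0)
  exact h.congr_of_eventuallyEq (Filter.Eventually.of_forall gig_aux_Phi_eq)

lemma gig_aux_Phi_tendsto : Filter.Tendsto stdNormalCDF Filter.atBot (nhds 0) := by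
  have h := intervalIntegral_tendsto_integral_Iic (μ := volume) (0:ℝ)
    (gig_aux_integrable.integrableOn) Filter.tendsto_id
  have h2 := h.const_sub (stdNormalCDF 0)
  have e : stdNormalCDF 0 - ∫ t in Set.Iic (0:ℝ),
      (Real.sqrt (2 * Real.pi))⁻¹ * Real.exp (-t ^ 2 / 2) = 0 := by
    unfold stdNormalCDF; simp
  rw [e] at h2
  refine h2.congr fun x => ?_
  rw [gig_aux_Phi_eq x, intervalIntegral.integral_symm]
  simp only [id]
  ring

/-- The distribution function in the variable `s = √z`. -/
noncomputable def gigH (μ lam s : ℝ) : ℝ :=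
  stdNormalCDF (Real.sqrt lam * (s / μ - 1 / s))
  + (lam ^ 2 - 3 * lam * μ + 3 * μ ^ 2) / (lam ^ 2 + 3 * lam * μ + 3 * μ ^ 2)
      * Real.exp (2 * lam / μ) * stdNormalCDF (-(Real.sqrt lam * (s / μ + 1 / s)))
  + 2 * Real.sqrt lam * μ ^ 2 / (lam ^ 2 + 3 * lam * μ + 3 * μ ^ 2)
      * (Real.sqrt (2 * Real.pi))⁻¹ * ((lam + 3 * s ^ 2) / s ^ 3)
      * Real.exp (lam / μ - lam * s ^ 2 / (2 * μ ^ 2) - lam / (2 * s ^ 2))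

lemma gig_aux_H_deriv (μ lam s : ℝ) (hμ : 0 < μ) (hlam : 0 < lam) (hs : 0 < s) :
    HasDerivAt (gigH μ lam)
      (2 * Real.sqrt lam * lam ^ 2 * μ ^ 2 / (lam ^ 2 + 3 * lam * μ + 3 * μ ^ 2)
        * (Real.sqrt (2 * Real.pi))⁻¹ / s ^ 6
        * Real.exp (lam / μ - lam * s ^ 2 / (2 * μ ^ 2) - lam / (2 * s ^ 2))) s := by
  have hs0 : s ≠ 0 := hs.ne'
  have hμ0 : μ ≠ 0 := hμ.ne'
  have hS : lam ^ 2 + 3 * lam * μ + 3 * μ ^ 2 ≠ 0 := by positivity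
  have hq : Real.sqrt lam ^ 2 = lam := Real.sq_sqrt hlam.le
  have hi : HasDerivAt (fun s : ℝ => 1 / s) (-1 / s ^ 2) s := by
    simpa [neg_div] using hasDerivAt_inv hs0
  have hd : HasDerivAt (fun s : ℝ => s / μ) (1 / μ) s := (hasDerivAt_id s).div_const μ
  have hA := (gig_aux_Phi_deriv (Real.sqrt lam * (s / μ - 1 / s))).comp s
    ((hd.sub hi).const_mul (Real.sqrt lam))
  have hB := (gig_aux_Phi_deriv (-(Real.sqrt lam * (s / μ + 1 / s)))).comp s
    ((hd.add hi).const_mul (Real.sqrt lam)).neg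
  have hR : HasDerivAt (fun s : ℝ => (lam + 3 * s ^ 2) / s ^ 3)
      (-3 * lam / s ^ 4 - 3 / s ^ 2) s := by
    have := (((hasDerivAt_pow 2 s).const_mul 3).const_add lam).div (hasDerivAt_pow 3 s)
      (pow_ne_zero 3 hs0)
    convert! this using 1
    field_simp
    push_cast
    ring
  have hE : HasDerivAt
      (fun s : ℝ => Real.exp (lam / μ - lam * s ^ 2 / (2 * μ ^ 2) - lam / (2 * s ^ 2)))
      (Real.exp (lam / μ - lam * s ^ 2 / (2 * μ ^ 2) - lam / (2 * s ^ 2))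
        * (- lam * s / μ ^ 2 + lam / s ^ 3)) s := by
    have h1 := (((hasDerivAt_pow 2 s).const_mul lam).div_const (2 * μ ^ 2)).const_sub (lam / μ)
    have h2 := (hasDerivAt_const s lam).div ((hasDerivAt_pow 2 s).const_mul 2)
      (by positivity)
    convert! (h1.sub h2).exp using 1
    congr 1
    field_simp
    push_cast
    ring
  have e1 : Real.exp (-(Real.sqrt lam * (s / μ - 1 / s)) ^ 2 / 2)
      = Real.exp (lam / μ - lam * s ^ 2 / (2 * μ ^ 2) - lam / (2 * s ^ 2)) := by
    congr 1
    rw [mul_pow, hq]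
    field_simp
    ring
  have e2 : Real.exp (-(-(Real.sqrt lam * (s / μ + 1 / s))) ^ 2 / 2)
      = Real.exp (lam / μ - lam * s ^ 2 / (2 * μ ^ 2) - lam / (2 * s ^ 2))
        * (Real.exp (2 * lam / μ))⁻¹ := by
    rw [← Real.exp_neg, ← Real.exp_add]
    congr 1
    rw [neg_sq, mul_pow, hq]
    field_simp
    ring
  rw [e1] at hA
  rw [e2] at hB
  have hT := (hA.add (hB.const_mul ((lam ^ 2 - 3 * lam * μ + 3 * μ ^ 2)
    / (lam ^ 2 + 3 * lam * μ + 3 * μ ^ 2) * Real.exp (2 * lam / μ)))).add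
    ((hR.const_mul (2 * Real.sqrt lam * μ ^ 2 / (lam ^ 2 + 3 * lam * μ + 3 * μ ^ 2)
      * (Real.sqrt (2 * Real.pi))⁻¹)).mul hE)
  have hx := (Real.exp_pos (2 * lam / μ)).ne'
  have hp : Real.sqrt (2 * Real.pi) ≠ 0 := by positivity
  convert! hT using 1
  generalize Real.exp (lam / μ - lam * s ^ 2 / (2 * μ ^ 2) - lam / (2 * s ^ 2)) = E
  generalize Real.exp (2 * lam / μ) = X at *
  generalize Real.sqrt (2 * Real.pi) = P at *
  generalize Real.sqrt lam = q
  field_simp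
  ring

lemma gig_aux_H_tendsto (μ lam : ℝ) (hμ : 0 < μ) (hlam : 0 < lam) :
    Filter.Tendsto (gigH μ lam) (nhdsWithin 0 (Set.Ioi 0)) (nhds 0) := by
  have hq : 0 < Real.sqrt lam := Real.sqrt_pos.2 hlam
  have hid : Filter.Tendsto (fun s : ℝ => s) (nhdsWithin 0 (Set.Ioi 0)) (nhds 0) :=
    Filter.tendsto_id.mono_left nhdsWithin_le_nhds
  have hinv : Filter.Tendsto (fun s : ℝ => 1 / s) (nhdsWithin 0 (Set.Ioi 0)) Filter.atTop := by
    simpa using tendsto_inv_nhdsGT_zero (𝕜 := ℝ)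
  have hdm : Filter.Tendsto (fun s : ℝ => s / μ) (nhdsWithin 0 (Set.Ioi 0)) (nhds (0 / μ)) :=
    hid.div_const μ
  have hA : Filter.Tendsto (fun s : ℝ => Real.sqrt lam * (s / μ - 1 / s))
      (nhdsWithin 0 (Set.Ioi 0)) Filter.atBot := by
    refine Filter.Tendsto.const_mul_atBot hq ?_
    simp only [sub_eq_add_neg]
    exact hdm.add_atBot (Filter.tendsto_neg_atTop_atBot.comp hinv)
  have hB : Filter.Tendsto (fun s : ℝ => -(Real.sqrt lam * (s / μ + 1 / s)))
      (nhdsWithin 0 (Set.Ioi 0)) Filter.atBot :=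
    Filter.tendsto_neg_atTop_atBot.comp
      (Filter.Tendsto.const_mul_atTop hq (hdm.add_atTop hinv))
  have hu : Filter.Tendsto (fun s : ℝ => lam / 2 * (1 / s) ^ 2)
      (nhdsWithin 0 (Set.Ioi 0)) Filter.atTop :=
    Filter.Tendsto.const_mul_atTop (by positivity)
      ((Filter.tendsto_pow_atTop (by norm_num)).comp hinv)
  have hG := (Real.tendsto_pow_mul_exp_neg_atTop_nhds_zero 2).comp hu
  have hC : Filter.Tendsto (fun s : ℝ => 2 * Real.sqrt lam * μ ^ 2
      / (lam ^ 2 + 3 * lam * μ + 3 * μ ^ 2)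
      * (Real.sqrt (2 * Real.pi))⁻¹ * (lam + 3 * s ^ 2) * s * (2 / lam) ^ 2
      * Real.exp (lam / μ - lam * s ^ 2 / (2 * μ ^ 2)))
      (nhdsWithin 0 (Set.Ioi 0)) (nhds 0) := by
    have : Continuous (fun s : ℝ => 2 * Real.sqrt lam * μ ^ 2
      / (lam ^ 2 + 3 * lam * μ + 3 * μ ^ 2)
      * (Real.sqrt (2 * Real.pi))⁻¹ * (lam + 3 * s ^ 2) * s * (2 / lam) ^ 2
      * Real.exp (lam / μ - lam * s ^ 2 / (2 * μ ^ 2))) := by fun_prop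
    have := (this.tendsto 0).mono_left (nhdsWithin_le_nhds (s := Set.Ioi 0))
    simpa using this
  have hT := ((gig_aux_Phi_tendsto.comp hA).add ((gig_aux_Phi_tendsto.comp hB).const_mul
    ((lam ^ 2 - 3 * lam * μ + 3 * μ ^ 2) / (lam ^ 2 + 3 * lam * μ + 3 * μ ^ 2)
      * Real.exp (2 * lam / μ)))).add (hC.mul hG)
  simp only [mul_zero, add_zero] at hT
  refine hT.congr' ?_
  filter_upwards [self_mem_nhdsWithin] with s hs
  have hs0 : s ≠ 0 := (Set.mem_Ioi.1 hs).ne'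
  simp only [gigH, Function.comp]
  congr 1
  have e : Real.exp (lam / μ - lam * s ^ 2 / (2 * μ ^ 2) - lam / (2 * s ^ 2))
      = Real.exp (lam / μ - lam * s ^ 2 / (2 * μ ^ 2)) * Real.exp (-(lam / 2 * (1 / s) ^ 2)) := by
    rw [← Real.exp_add]
    congr 1
    field_simp
    ring
  rw [e]
  generalize Real.exp (lam / μ - lam * s ^ 2 / (2 * μ ^ 2)) = E
  generalize Real.exp (-(lam / 2 * (1 / s) ^ 2)) = X
  have hp : Real.sqrt (2 * Real.pi) ≠ 0 := by positivity
  have hS : lam ^ 2 + 3 * lam * μ + 3 * μ ^ 2 ≠ 0 := by positivity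
  field_simp

lemma gig_aux_rpow (z : ℝ) (hz : 0 < z) (n : ℕ) : z ^ ((n:ℝ)/2) = Real.sqrt z ^ n := by
  rw [Real.sqrt_eq_rpow, ← Real.rpow_natCast, ← Real.rpow_mul hz.le]
  congr 1
  ring

/-- C.d.f. of the generalized inverse Gaussian distribution with `p = −5/2`. -/
theorem gig_cdf_neg_five_half (μ lam x : ℝ) (hμ : 0 < μ) (hlam : 0 < lam) (hx : 0 < x) :
    (∫ z in (0:ℝ)..x,
        lam ^ ((5:ℝ)/2) * μ ^ 2
            / (Real.sqrt (2 * Real.pi) * (lam ^ 2 + 3 * lam * μ + 3 * μ ^ 2))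
          * z ^ (-(7:ℝ)/2) * gigE z μ lam)
      = stdNormalCDF (Real.sqrt (lam / x) * (x / μ - 1))
        + (lam ^ 2 - 3 * lam * μ + 3 * μ ^ 2) / (lam ^ 2 + 3 * lam * μ + 3 * μ ^ 2)
            * Real.exp (2 * lam / μ)
            * stdNormalCDF (-(Real.sqrt (lam / x)) * (x / μ + 1))
        + Real.sqrt (2 * lam) * μ ^ 2 * (lam + 3 * x)
            / (Real.sqrt Real.pi * (lam ^ 2 + 3 * lam * μ + 3 * μ ^ 2) * x ^ ((3:ℝ)/2))
            * Real.exp (lam / μ) * Real.exp (-(lam / (2 * x)) * (x ^ 2 / μ ^ 2 + 1)) := by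
  have hS : lam ^ 2 + 3 * lam * μ + 3 * μ ^ 2 ≠ 0 := by positivity
  have hp : Real.sqrt (2 * Real.pi) ≠ 0 := by positivity
  have hder : ∀ z : ℝ, 0 < z → HasDerivAt (fun z => gigH μ lam (Real.sqrt z))
      (lam ^ ((5:ℝ)/2) * μ ^ 2
            / (Real.sqrt (2 * Real.pi) * (lam ^ 2 + 3 * lam * μ + 3 * μ ^ 2))
          * z ^ (-(7:ℝ)/2) * gigE z μ lam) z := by
    intro z hz
    have hsz : 0 < Real.sqrt z := Real.sqrt_pos.2 hz
    have hqz : Real.sqrt z ^ 2 = z := Real.sq_sqrt hz.le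
    have h := (gig_aux_H_deriv μ lam (Real.sqrt z) hμ hlam hsz).comp z
      (Real.hasDerivAt_sqrt hz.ne')
    convert! h using 1
    have e1 : lam ^ ((5:ℝ)/2) = Real.sqrt lam * lam ^ 2 := by
      have := gig_aux_rpow lam hlam 5
      have hq : Real.sqrt lam ^ 2 = lam := Real.sq_sqrt hlam.le
      push_cast at this
      rw [this]
      calc Real.sqrt lam ^ 5 = Real.sqrt lam * (Real.sqrt lam ^ 2) ^ 2 := by ring
        _ = _ := by rw [hq]
    have e2 : z ^ (-(7:ℝ)/2) = (Real.sqrt z ^ 7)⁻¹ := by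
      have := gig_aux_rpow z hz 7
      push_cast at this
      rw [neg_div, Real.rpow_neg hz.le, this]
    have e3 : gigE z μ lam = Real.exp (lam / μ - lam * Real.sqrt z ^ 2 / (2 * μ ^ 2)
        - lam / (2 * Real.sqrt z ^ 2)) := by
      rw [hqz]
      unfold gigE
      congr 1
      field_simp
      ring
    rw [e1, e2, e3]
    generalize Real.exp (lam / μ - lam * Real.sqrt z ^ 2 / (2 * μ ^ 2)
        - lam / (2 * Real.sqrt z ^ 2)) = E
    field_simp
  have hlim : Filter.Tendsto (fun z => gigH μ lam (Real.sqrt z))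
      (nhdsWithin 0 (Set.Ioi 0)) (nhds 0) := by
    refine (gig_aux_H_tendsto μ lam hμ hlam).comp ?_
    refine tendsto_nhdsWithin_iff.2 ⟨?_, ?_⟩
    · have := (Real.continuous_sqrt.tendsto 0).mono_left (nhdsWithin_le_nhds (s := Set.Ioi 0))
      simpa using this
    · filter_upwards [self_mem_nhdsWithin] with z hz
      exact Real.sqrt_pos.2 hz
  have hright := (hder x hx).continuousAt.tendsto.mono_left (nhdsWithin_le_nhds (s := Set.Iio x))
  have hcont : ContinuousOn (Function.update (fun z => gigH μ lam (Real.sqrt z)) 0 0)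
      (Set.Icc 0 x) := by
    rw [continuousOn_update_iff]
    refine ⟨fun z hz => (hder z (lt_of_le_of_ne hz.1.1 (Ne.symm hz.2))).continuousAt.continuousWithinAt,
      fun _ => hlim.mono_left (nhdsWithin_mono _ fun z hz => lt_of_le_of_ne hz.1.1 (Ne.symm hz.2))⟩
  have hint := intervalIntegral.integrableOn_deriv_of_nonneg hcont
    (g' := fun z => lam ^ ((5:ℝ)/2) * μ ^ 2
            / (Real.sqrt (2 * Real.pi) * (lam ^ 2 + 3 * lam * μ + 3 * μ ^ 2))
          * z ^ (-(7:ℝ)/2) * gigE z μ lam)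
    (fun z hz => (hder z hz.1).congr_of_eventuallyEq (by
      filter_upwards [lt_mem_nhds hz.1] with y hy
      exact Function.update_of_ne (ne_of_gt hy) _ _))
    (fun z hz => by
      have := hz.1
      unfold gigE
      positivity)
  rw [intervalIntegral.integral_eq_sub_of_hasDerivAt_of_tendsto hx (fun z hz => hder z hz.1)
    ((intervalIntegrable_iff_integrableOn_Ioc_of_le hx.le).2 hint) hlim hright, sub_zero]
  have hsx : 0 < Real.sqrt x := Real.sqrt_pos.2 hx
  have hqx : Real.sqrt x ^ 2 = x := Real.sq_sqrt hx.le
  have hpi : 0 < Real.sqrt Real.pi := Real.sqrt_pos.2 Real.pi_pos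
  have e3 : x ^ ((3:ℝ)/2) = Real.sqrt x ^ 3 := by
    have := gig_aux_rpow x hx 3
    push_cast at this
    exact this
  unfold gigH
  rw [Real.sqrt_div hlam.le, e3, Real.sqrt_mul (by norm_num : (0:ℝ) ≤ 2),
    Real.sqrt_mul (by norm_num : (0:ℝ) ≤ 2), mul_assoc _ (Real.exp (lam / μ)), ← Real.exp_add]
  have h2 : Real.sqrt 2 ^ 2 = 2 := Real.sq_sqrt (by norm_num)
  have h20 : 0 < Real.sqrt 2 := by positivity
  congr 1
  · congr 1
    · congr 1
      nth_rewrite 4 [← hqx]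
      field_simp
    · congr 2
      nth_rewrite 4 [← hqx]
      field_simp
  · rw [hqx]
    congr 1
    · field_simp
      rw [h2]
    · congr 1
      field_simp
      ring
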